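/- arXiv:2206.00589 — 3 statements merged into one kernel-verified Lean document; each statement's English description precedes it below -/
import Mathlib

section
/- A positive integer m is represented by the ternary quadratic form x^2 + 3y^2 + 2yz + 5z^2 (i.e., there exist integers x, y, z with x^2 + 3y^2 + 2yz + 5z^2 = m) if and only if m is not of the form 4^k(16ℓ + 2) for any nonnegative integers k and ℓ. -/
open scoped NumberTheorySymbols

/-- The adjoint of the ternary form `a x² + b y² + c z² + 2 d y z + 2 e x z + 2 g x y`. -/
def adjointForm (a b c d e g u v w : ℤ) : ℤ :=
  (b * c - d ^ 2) * u ^ 2 + (a * c - e ^ 2) * v ^ 2 + (a * b - g ^ 2) * w ^ 2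
    + 2 * (d * e - g * c) * u * v + 2 * (g * d - b * e) * u * w + 2 * (g * e - a * d) * v * w

/-- The form `a x² + b y² + c z² + 2 d y z + 2 e x z + 2 g x y` is positive definite of
determinant `14`, is isotropic over the `7`-adic integers, and represents `m`. -/
structure IsAdmissible (m a b c d e g : ℤ) : Prop where
  pos : 0 < a
  minor_pos : 0 < a * b - g ^ 2
  det : a * b * c + 2 * d * e * g - a * d ^ 2 - b * e ^ 2 - c * g ^ 2 = 14
  represents : ∃ x y z : ℤ,
    a * x ^ 2 + b * y ^ 2 + c * z ^ 2 + 2 * d * y * z + 2 * e * x * z + 2 * g * x * y = m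
  adjoint_mod : ∀ u v w : ℤ, adjointForm a b c d e g u v w % 7 ≠ 1 ∧
    adjointForm a b c d e g u v w % 7 ≠ 2 ∧ adjointForm a b c d e g u v w % 7 ≠ 4

namespace IsAdmissible

variable {m a b c d e g : ℤ}

theorem swap_fst_snd (h : IsAdmissible m a b c d e g) : IsAdmissible m b a c e d g := by
  obtain ⟨ha, hb, hd, ⟨x, y, z, hx⟩, h7⟩ := h
  refine ⟨?_, by linarith, by linarith, ⟨y, x, z, by linarith⟩, fun u v w ↦ ?_⟩
  · exact pos_of_mul_pos_right (by nlinarith [sq_nonneg g]) ha.le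
  · have : adjointForm b a c e d g u v w = adjointForm a b c d e g v u w := by
      unfold adjointForm; ring
    rw [this]
    exact h7 v u w

theorem swap_snd_trd (h : IsAdmissible m a b c d e g) : IsAdmissible m a c b d g e := by
  obtain ⟨ha, hb, hd, ⟨x, y, z, hx⟩, h7⟩ := h
  refine ⟨ha, ?_, by linarith, ⟨x, z, y, by linarith⟩, fun u v w ↦ ?_⟩
  · have key : (a * b - g ^ 2) * (a * c - e ^ 2) = 14 * a + (a * d - e * g) ^ 2 := by
      linear_combination a * hd
    exact pos_of_mul_pos_right (by rw [key]; positivity) hb.le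
  · have : adjointForm a c b d g e u v w = adjointForm a b c d e g u w v := by
      unfold adjointForm; ring
    rw [this]
    exact h7 u w v

theorem add_fst_to_snd (h : IsAdmissible m a b c d e g) (k : ℤ) :
    IsAdmissible m a (b + 2 * k * g + k ^ 2 * a) c (d + k * e) e (g + k * a) := by
  obtain ⟨ha, hb, hd, ⟨x, y, z, hx⟩, h7⟩ := h
  refine ⟨ha, by linarith, by linarith, ⟨x - k * y, y, z, by linarith⟩, fun u v w ↦ ?_⟩
  have : adjointForm a (b + 2 * k * g + k ^ 2 * a) c (d + k * e) e (g + k * a) u v w =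
      adjointForm a b c d e g u (v - k * u) w := by
    unfold adjointForm; ring
  rw [this]
  exact h7 u (v - k * u) w

theorem add_fst_to_trd (h : IsAdmissible m a b c d e g) (k : ℤ) :
    IsAdmissible m a b (c + 2 * k * e + k ^ 2 * a) (d + k * g) (e + k * a) g :=
  (h.swap_snd_trd.add_fst_to_snd k).swap_snd_trd

theorem add_snd_to_trd (h : IsAdmissible m a b c d e g) (k : ℤ) :
    IsAdmissible m a b (c + 2 * k * d + k ^ 2 * b) (d + k * b) (e + k * g) g :=
  (h.swap_fst_snd.add_fst_to_trd k).swap_fst_snd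

end IsAdmissible

theorem Int.exists_two_mul_abs_add_mul_le (n : ℤ) {a : ℤ} (ha : 0 < a) :
    ∃ k : ℤ, 2 * |n + k * a| ≤ a := by
  refine ⟨-((2 * n + a) / (2 * a)), ?_⟩
  have h1 := Int.emod_add_mul_ediv (2 * n + a) (2 * a)
  have h2 := Int.emod_nonneg (2 * n + a) (show 2 * a ≠ 0 by omega)
  have h3 := Int.emod_lt_of_pos (2 * n + a) (show 0 < 2 * a by omega)
  have : |2 * (n + -((2 * n + a) / (2 * a)) * a)| ≤ a := abs_le.2 ⟨by linarith, by linarith⟩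
  rwa [abs_mul, abs_two] at this

/-- Reduction theory: an admissible form is equivalent to one satisfying Hermite's conditions. -/
theorem IsAdmissible.exists_reduced {m a b c d e g : ℤ} (h : IsAdmissible m a b c d e g) :
    ∃ a b c d e g : ℤ, IsAdmissible m a b c d e g ∧ a ≤ b ∧ 2 * |g| ≤ a ∧ 2 * |e| ≤ a ∧
      2 * |a * d - e * g| ≤ a * b - g ^ 2 ∧ a * b - g ^ 2 ≤ a * c - e ^ 2 := by
  obtain ⟨a, ⟨b, c, d, e, g, h⟩, hmin⟩ := Int.exists_least_of_bdd
    (P := fun a ↦ ∃ b c d e g, IsAdmissible m a b c d e g)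
    ⟨0, fun _ ⟨_, _, _, _, _, h⟩ ↦ h.pos.le⟩ ⟨a, b, c, d, e, g, h⟩
  obtain ⟨β, ⟨b, c, d, e, g, h, rfl⟩, hmin'⟩ := Int.exists_least_of_bdd
    (P := fun β ↦ ∃ b c d e g, IsAdmissible m a b c d e g ∧ a * b - g ^ 2 = β)
    ⟨0, fun _ ⟨_, _, _, _, _, h, h'⟩ ↦ h' ▸ h.minor_pos.le⟩ ⟨_, b, c, d, e, g, h, rfl⟩
  obtain ⟨k, hk⟩ := Int.exists_two_mul_abs_add_mul_le (a * d - e * g) h.minor_pos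
  obtain ⟨l, hl⟩ := Int.exists_two_mul_abs_add_mul_le g h.pos
  obtain ⟨n, hn⟩ := Int.exists_two_mul_abs_add_mul_le (e + k * g) h.pos
  have h' := ((h.add_snd_to_trd k).add_fst_to_snd l).add_fst_to_trd n
  refine ⟨_, _, _, _, _, _, h', hmin _ ⟨_, _, _, _, _, h'.swap_fst_snd⟩, hl, hn, ?_, ?_⟩
  · have h1 : a * (b + 2 * l * g + l ^ 2 * a) - (g + l * a) ^ 2 = a * b - g ^ 2 := by ring
    rw [h1]
    refine le_of_eq_of_le (congrArg (2 * |·|) ?_) hk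
    ring
  · refine le_of_eq_of_le ?_ (hmin' _ ⟨_, _, _, _, _, h'.swap_snd_trd, rfl⟩)
    ring

theorem IsAdmissible.represented {m a b c d e g : ℤ} (h : IsAdmissible m a b c d e g) :
    ∃ x y z : ℤ, x ^ 2 + 3 * y ^ 2 + 2 * y * z + 5 * z ^ 2 = m := by
  obtain ⟨a, b, c, d, e, g, ⟨ha, hβ, hdet, ⟨x, y, z, hm⟩, h7⟩, hab, hg, he, hγ, hβδ⟩ :=
    h.exists_reduced
  have h7 := h7 0 0 1
  rw [show adjointForm a b c d e g 0 0 1 = a * b - g ^ 2 by unfold adjointForm; ring] at h7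
  have hγ2 := abs_le.1 (show |2 * (a * d - e * g)| ≤ a * b - g ^ 2 by rwa [abs_mul, abs_two])
  have hg2 := abs_le.1 (show |2 * g| ≤ a by rwa [abs_mul, abs_two])
  have he2 := abs_le.1 (show |2 * e| ≤ a by rwa [abs_mul, abs_two])
  have key : (a * b - g ^ 2) * (a * c - e ^ 2) = 14 * a + (a * d - e * g) ^ 2 := by
    linear_combination a * hdet
  have hβ2 : 3 * (a * b - g ^ 2) ^ 2 ≤ 56 * a := by
    nlinarith [mul_le_mul_of_nonneg_left hβδ hβ.le]
  have ha2 : 3 * a ^ 2 ≤ 4 * (a * b - g ^ 2) := by nlinarith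
  have ha3 : a ≤ 3 := by
    by_contra! h4
    have : 9 * (a ^ 2) ^ 2 ≤ 16 * (a * b - g ^ 2) ^ 2 := by nlinarith
    nlinarith [mul_pos ha ha, mul_pos (mul_pos ha ha) ha, mul_nonneg ha.le (sq_nonneg (a - 4))]
  have hβ8 : a * b - g ^ 2 < 8 := by nlinarith
  interval_cases a
  · obtain rfl : g = 0 := by omega
    obtain rfl : e = 0 := by omega
    have hb : b ≤ 4 := by nlinarith
    obtain rfl : b = 3 := by omega
    obtain ⟨hd1, hd2⟩ : -1 ≤ d ∧ d ≤ 1 := by omega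
    interval_cases d
    · obtain rfl : c = 5 := by omega
      exact ⟨x, y, -z, by linarith⟩
    · omega
    · obtain rfl : c = 5 := by omega
      exact ⟨x, y, z, by linarith⟩
  · obtain ⟨hg3, hg4⟩ : -1 ≤ g ∧ g ≤ 1 := by omega
    obtain ⟨he3, he4⟩ : -1 ≤ e ∧ e ≤ 1 := by omega
    have hβ6 : 2 * b - g ^ 2 ≤ 6 := by nlinarith
    clear hβ2 key hm
    interval_cases g <;> interval_cases e <;>
    · have hb : b ≤ 3 := by omega
      interval_cases b <;>
      · obtain ⟨hd1, hd2⟩ : -2 ≤ d ∧ d ≤ 2 := by omega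
        interval_cases d <;> omega
  · obtain ⟨hg3, hg4⟩ : -1 ≤ g ∧ g ≤ 1 := by omega
    interval_cases g <;> omega

theorem Nat.exists_sq_add_dvd_of_jacobiSym_eq_one {p : ℕ} (hp : p.Prime) {b : ℤ}
    (h : J(-b | p) = 1) : ∃ r : ℤ, (p : ℤ) ∣ r ^ 2 + b := by
  have : Fact p.Prime := ⟨hp⟩
  obtain ⟨s, hs⟩ := ZMod.isSquare_of_jacobiSym_eq_one h
  obtain ⟨r, rfl⟩ := ZMod.intCast_surjective s
  refine ⟨r, (ZMod.intCast_zmod_eq_zero_iff_dvd _ p).1 ?_⟩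
  push_cast at hs ⊢
  linear_combination -hs

theorem Int.exists_sq_add_dvd_mul {p q b : ℤ} (hpq : IsCoprime p q)
    (hp : ∃ r, p ∣ r ^ 2 + b) (hq : ∃ r, q ∣ r ^ 2 + b) : ∃ r, p * q ∣ r ^ 2 + b := by
  obtain ⟨r, hr⟩ := hp
  obtain ⟨s, hs⟩ := hq
  obtain ⟨u, v, huv⟩ := hpq
  refine ⟨r * (v * q) + s * (u * p), IsCoprime.mul_dvd ⟨u, v, huv⟩ ?_ ?_⟩
  · have hX : r * (v * q) + s * (u * p) - r = p * (u * (s - r)) := by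
      linear_combination r * huv
    convert! dvd_add hr (Dvd.intro (u * (s - r) * (r * (v * q) + s * (u * p) + r)) rfl) using 1
    linear_combination (r * (v * q) + s * (u * p) + r) * hX
  · have hX : r * (v * q) + s * (u * p) - s = q * (v * (r - s)) := by
      linear_combination s * huv
    convert! dvd_add hs (Dvd.intro (v * (r - s) * (r * (v * q) + s * (u * p) + s)) rfl) using 1
    linear_combination (r * (v * q) + s * (u * p) + s) * hX

/-- If `b m - t² A = 14` with `-b` a square modulo `A` and a nonzero square modulo `7`, then `m`
is represented: it is a value of a form of determinant `14` having `b` as a minor. -/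
theorem represented_of_square_neg {m b A t : ℤ} (hb : 0 < b) (hA : 0 < A)
    (h : b * m - t ^ 2 * A = 14) (hr : ∃ r, A ∣ r ^ 2 + b)
    (hb7 : b % 7 = 3 ∨ b % 7 = 5 ∨ b % 7 = 6) :
    ∃ x y z : ℤ, x ^ 2 + 3 * y ^ 2 + 2 * y * z + 5 * z ^ 2 = m := by
  obtain ⟨r, a, ha⟩ := hr
  have hminor : a * A - r ^ 2 = b := by linarith
  have hdet : a * A * m + 2 * 0 * t * r - a * 0 ^ 2 - A * t ^ 2 - m * r ^ 2 = 14 := by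
    linear_combination h + m * hminor
  refine IsAdmissible.represented (a := a) (b := A) (c := m) (d := 0) (e := t) (g := r)
    ⟨pos_of_mul_pos_right (by nlinarith [sq_nonneg r]) hA.le, by rwa [hminor], hdet,
      ⟨0, 0, 1, by ring⟩, fun u v w ↦ ?_⟩
  set N := adjointForm a A m 0 t r u v w with hN
  have key : b * N = (b * w - A * t * u + r * t * v) ^ 2
      + 14 * (A * u ^ 2 - 2 * r * u * v + a * v ^ 2) := by
    rw [hN, ← hdet, ← hminor]
    unfold adjointForm
    ring
  generalize b * w - A * t * u + r * t * v = s at key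
  have hs : s ^ 2 % 7 = 0 ∨ s ^ 2 % 7 = 1 ∨ s ^ 2 % 7 = 2 ∨ s ^ 2 % 7 = 4 := by
    have : s % 7 = 0 ∨ s % 7 = 1 ∨ s % 7 = 2 ∨ s % 7 = 3 ∨ s % 7 = 4 ∨ s % 7 = 5 ∨ s % 7 = 6 := by
      omega
    rcases this with h | h | h | h | h | h | h <;> simp [pow_two, Int.mul_emod, h]
  have hmod : b * N % 7 = s ^ 2 % 7 := by omega
  rw [Int.mul_emod] at hmod
  refine ⟨fun h ↦ ?_, fun h ↦ ?_, fun h ↦ ?_⟩ <;> rw [h] at hmod <;>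
    rcases hb7 with h' | h' | h' <;> rw [h'] at hmod <;> omega

/-- An instance of Dirichlet's theorem: the prime values `p` of `(b n - D) / i`. -/
theorem exists_prime_mul_sub_eq {n i j b₀ c D : ℤ} (hn : 0 < n) (hi : 0 < i) (hij : i * j = 56)
    (hc : b₀ * n - i * c = D) (hD : 0 < D) (hD14 : D ∣ 14) (hc2 : c % 2 = 1) (hc7 : c % 7 ≠ 0) :
    ∃ p b : ℕ, 7 < p ∧ p.Prime ∧ (b : ℤ) % 56 = b₀ % 56 ∧ b * n - i * p = D := by
  have h2 : IsCoprime c 2 :=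
    ((Int.prime_two.coprime_iff_not_dvd).2 (by omega)).symm
  have h7 : IsCoprime c 7 :=
    (((Nat.prime_iff_prime_int.1 (by norm_num : Nat.Prime 7)).coprime_iff_not_dvd).2
      (by push_cast; omega)).symm
  have hDc : IsCoprime c D := (h2.mul_right h7).of_isCoprime_of_dvd_right (by simpa using hD14)
  have hcn : IsCoprime c n := by
    refine IsCoprime.of_mul_right_right (y := b₀) ?_
    rw [show b₀ * n = D + i * c by linarith]
    exact hDc.add_mul_right_right i
  have hcj : IsCoprime c j :=
    ((h2.pow_right (n := 3)).mul_right h7).of_isCoprime_of_dvd_right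
      (Dvd.intro_left i (by rw [hij]; norm_num))
  have hj : 0 < j := pos_of_mul_pos_right (by rw [hij]; norm_num) hi.le
  obtain ⟨k, hk⟩ : ∃ k : ℕ, (k : ℤ) = j * n := ⟨(j * n).toNat, by simp; positivity⟩
  obtain ⟨p, hp7, hp, hpc⟩ := Nat.forall_exists_prime_gt_and_zmodEq 7 (q := k) (a := c)
    (by rintro rfl; exact (mul_pos hj hn).ne hk) (by rw [hk]; exact hcj.mul_right hcn)
  obtain ⟨t, ht⟩ := hpc.symm.dvd
  rw [hk] at ht
  have hb : (b₀ + 56 * t) * n - i * p = D := by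
    linear_combination hc - i * ht - n * t * hij
  have hb0 : 0 < b₀ + 56 * t := by
    refine pos_of_mul_pos_left (b := n) ?_ hn.le
    have : 0 < i * p := by positivity
    linarith
  lift b₀ + 56 * t to ℕ using hb0.le with b hb'
  exact ⟨p, b, hp7, hp, by omega, hb⟩

theorem jacobiSym_neg_seven {b : ℕ} (hb : Odd b) : J(-7 | b) = J(b | 7) := by
  rw [jacobiSym.neg _ hb]
  rcases Nat.odd_mod_four_iff.1 (Nat.odd_iff.1 hb) with h | h
  · rw [ZMod.χ₄_nat_one_mod_four h, one_mul]
    exact jacobiSym.quadratic_reciprocity_one_mod_four' (by decide) h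
  · rw [ZMod.χ₄_nat_three_mod_four h]
    have := jacobiSym.quadratic_reciprocity_three_mod_four (show 7 % 4 = 3 by rfl) h
    push_cast at this
    rw [this]; ring

theorem jacobiSym_seven_eq_neg_one {b : ℤ} (hb : b % 7 = 3 ∨ b % 7 = 5 ∨ b % 7 = 6) :
    J(b | 7) = -1 := by
  rw [jacobiSym.mod_left]
  rcases hb with h | h | h <;> (push_cast; rw [h]; norm_num)

theorem jacobiSym_mul_of_mul_sub_eq {b p : ℕ} {n i D : ℤ} (h : b * n - i * p = D) :
    J(i | b) * J(p | b) = J(-D | b) := by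
  rw [← jacobiSym.mul_left]
  refine jacobiSym.mod_left' ?_
  rw [← h, neg_sub, sub_eq_add_neg, ← mul_neg, Int.add_mul_emod_self_left]

theorem jacobiSym_neg_of_mod_eight_eq_three {b p : ℕ} (hb : b % 8 = 3) (hp : Odd p) :
    J(-b | p) = J(p | b) := by
  rw [jacobiSym.neg _ hp]
  rcases Nat.odd_mod_four_iff.1 (Nat.odd_iff.1 hp) with h | h
  · rw [ZMod.χ₄_nat_one_mod_four h, one_mul]
    exact jacobiSym.quadratic_reciprocity_one_mod_four' (Nat.odd_iff.2 (by omega)) h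
  · rw [ZMod.χ₄_nat_three_mod_four h,
      jacobiSym.quadratic_reciprocity_three_mod_four (by omega) h]
    ring

theorem jacobiSym_neg_of_mod_four_eq_one {b p : ℕ} (hb : b % 4 = 1) (hp : Odd p) :
    J(-b | p) = ZMod.χ₄ p * J(p | b) := by
  rw [jacobiSym.neg _ hp, jacobiSym.quadratic_reciprocity_one_mod_four hb hp]

theorem jacobiSym_values_of_mod_eight_eq_three {b : ℕ} (hb : b % 8 = 3) :
    J(2 | b) = -1 ∧ J(-2 | b) = 1 ∧ J(-1 | b) = -1 := by
  have hodd : Odd b := Nat.odd_iff.2 (by omega)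
  rw [jacobiSym.at_two hodd, jacobiSym.at_neg_two hodd, jacobiSym.at_neg_one hodd,
    ZMod.χ₈_nat_eq_if_mod_eight, ZMod.χ₈'_nat_eq_if_mod_eight,
    ZMod.χ₄_nat_three_mod_four (by omega)]
  simp [hb, show b % 2 = 1 by omega]

theorem jacobiSym_values_of_mod_eight_eq_one {b : ℕ} (hb : b % 8 = 1) :
    J(2 | b) = 1 ∧ J(-1 | b) = 1 := by
  have hodd : Odd b := Nat.odd_iff.2 (by omega)
  rw [jacobiSym.at_two hodd, jacobiSym.at_neg_one hodd, ZMod.χ₈_nat_eq_if_mod_eight,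
    ZMod.χ₄_nat_one_mod_four (by omega)]
  simp [hb, show b % 2 = 1 by omega]

theorem represented_of_jacobiSym_eq_one {m t A : ℤ} {b p : ℕ} (hp7 : 7 < p) (hp : p.Prime)
    (hA : A = p ∨ A = 7 * p) (h : b * m - t ^ 2 * A = 14) (hJ : J(-b | p) = 1)
    (hb7 : (b : ℤ) % 7 = 3 ∨ (b : ℤ) % 7 = 5 ∨ (b : ℤ) % 7 = 6) :
    ∃ x y z : ℤ, x ^ 2 + 3 * y ^ 2 + 2 * y * z + 5 * z ^ 2 = m := by
  have hr := Nat.exists_sq_add_dvd_of_jacobiSym_eq_one hp hJ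
  refine represented_of_square_neg (by omega) (by omega) h ?_ hb7
  rcases hA with rfl | rfl
  · exact hr
  · refine Int.exists_sq_add_dvd_mul ?_ ?_ hr
    · exact_mod_cast (Nat.coprime_primes (by norm_num) hp).2 hp7.ne
    · rcases hb7 with h | h | h
      exacts [⟨2, by omega⟩, ⟨3, by omega⟩, ⟨1, by omega⟩]

theorem represented_of_odd {m : ℤ} (hm : 0 < m) (hodd : m % 2 = 1) :
    ∃ x y z : ℤ, x ^ 2 + 3 * y ^ 2 + 2 * y * z + 5 * z ^ 2 = m := by
  by_cases h7 : 7 ∣ m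
  · obtain ⟨n, rfl⟩ := h7
    obtain ⟨b₀, hb₀, hc⟩ : ∃ b₀ : ℤ, (b₀ = 3 ∨ b₀ = 19) ∧ (b₀ * n - 2) % 7 ≠ 0 := by
      by_cases h : (3 * n - 2) % 7 = 0
      exacts [⟨19, by omega, by omega⟩, ⟨3, by omega, by omega⟩]
    obtain ⟨p, b, hp7, hp, hb, h⟩ := exists_prime_mul_sub_eq (n := n) (i := 1) (j := 56)
      (b₀ := b₀) (c := b₀ * n - 2) (D := 2) (by omega) one_pos rfl (by ring) two_pos (by norm_num)
      (by rcases hb₀ with rfl | rfl <;> omega) hc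
    have hb8 : b % 8 = 3 := by omega
    obtain ⟨_, h2, _⟩ := jacobiSym_values_of_mod_eight_eq_three hb8
    have hJ := jacobiSym_mul_of_mul_sub_eq h
    rw [jacobiSym.one_left, one_mul, h2] at hJ
    refine represented_of_jacobiSym_eq_one (t := 1) hp7 hp (.inr rfl) (by linarith) ?_ (by omega)
    rw [jacobiSym_neg_of_mod_eight_eq_three hb8 (hp.odd_of_ne_two (by omega)), hJ]
  · obtain ⟨p, b, hp7, hp, hb, h⟩ := exists_prime_mul_sub_eq (n := m) (i := 1) (j := 56)
      (b₀ := 3) (c := 3 * m - 14) (D := 14) hm one_pos rfl (by ring) (by norm_num) (by norm_num)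
      (by omega) (by omega)
    have hb8 : b % 8 = 3 := by omega
    obtain ⟨h2, _, _⟩ := jacobiSym_values_of_mod_eight_eq_three hb8
    have hJ := jacobiSym_mul_of_mul_sub_eq h
    rw [jacobiSym.one_left, one_mul, show (-14 : ℤ) = 2 * -7 by norm_num, jacobiSym.mul_left, h2,
      jacobiSym_neg_seven (Nat.odd_iff.2 (by omega)), jacobiSym_seven_eq_neg_one (by omega)] at hJ
    refine represented_of_jacobiSym_eq_one (t := 1) hp7 hp (.inl rfl) (by linarith) ?_ (by omega)
    rw [jacobiSym_neg_of_mod_eight_eq_three hb8 (hp.odd_of_ne_two (by omega)), hJ]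
    norm_num

theorem represented_two_mul_of_mod_four_eq_three {n : ℤ} (hn : 0 < n) (hn4 : n % 4 = 3) :
    ∃ x y z : ℤ, x ^ 2 + 3 * y ^ 2 + 2 * y * z + 5 * z ^ 2 = 2 * n := by
  by_cases h7 : 7 ∣ n
  · obtain ⟨n, rfl⟩ := h7
    obtain ⟨b₀, hb₀, hc7⟩ : ∃ b₀ : ℤ, (b₀ = 3 ∨ b₀ = 19) ∧ (b₀ * n - 1) % 7 ≠ 0 := by
      by_cases h : (3 * n - 1) % 7 = 0
      exacts [⟨19, by omega, by omega⟩, ⟨3, by omega, by omega⟩]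
    obtain ⟨c, hc⟩ : ∃ c, b₀ * n - 2 * c = 1 :=
      ⟨(b₀ * n - 1) / 2, by rcases hb₀ with rfl | rfl <;> omega⟩
    obtain ⟨p, b, hp7, hp, hb, h⟩ := exists_prime_mul_sub_eq (j := 28)
      (by omega) two_pos rfl hc one_pos (by norm_num)
      (by rcases hb₀ with rfl | rfl <;> omega) (by omega)
    have hb8 : b % 8 = 3 := by omega
    obtain ⟨h2, _, h1⟩ := jacobiSym_values_of_mod_eight_eq_three hb8
    have hJ := jacobiSym_mul_of_mul_sub_eq h
    rw [h2, h1] at hJ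
    refine represented_of_jacobiSym_eq_one (t := 2) hp7 hp (.inr rfl) (by linarith) ?_ (by omega)
    rw [jacobiSym_neg_of_mod_eight_eq_three hb8 (hp.odd_of_ne_two (by omega))]
    linarith
  · obtain ⟨c, hc⟩ : ∃ c, 3 * n - 2 * c = 7 := ⟨(3 * n - 7) / 2, by omega⟩
    obtain ⟨p, b, hp7, hp, hb, h⟩ := exists_prime_mul_sub_eq (j := 28)
      hn two_pos rfl hc (by norm_num) (by norm_num) (by omega) (by omega)
    have hb8 : b % 8 = 3 := by omega
    obtain ⟨h2, _, _⟩ := jacobiSym_values_of_mod_eight_eq_three hb8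
    have hJ := jacobiSym_mul_of_mul_sub_eq h
    rw [h2, jacobiSym_neg_seven (Nat.odd_iff.2 (by omega)),
      jacobiSym_seven_eq_neg_one (by omega)] at hJ
    refine represented_of_jacobiSym_eq_one (t := 2) hp7 hp (.inl rfl) (by linarith) ?_ (by omega)
    rw [jacobiSym_neg_of_mod_eight_eq_three hb8 (hp.odd_of_ne_two (by omega))]
    linarith

theorem represented_two_mul_of_mod_eight_eq_five {n : ℤ} (hn : 0 < n) (hn8 : n % 8 = 5) :
    ∃ x y z : ℤ, x ^ 2 + 3 * y ^ 2 + 2 * y * z + 5 * z ^ 2 = 2 * n := by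
  by_cases h7 : 7 ∣ n
  · obtain ⟨n, rfl⟩ := h7
    obtain ⟨b₀, hb₀, hc7⟩ : ∃ b₀ : ℤ, (b₀ = 17 ∨ b₀ = 33) ∧ (b₀ * n - 1) % 7 ≠ 0 := by
      by_cases h : (17 * n - 1) % 7 = 0
      exacts [⟨33, by omega, by omega⟩, ⟨17, by omega, by omega⟩]
    obtain ⟨c, hc⟩ : ∃ c, b₀ * n - 2 * c = 1 :=
      ⟨(b₀ * n - 1) / 2, by rcases hb₀ with rfl | rfl <;> omega⟩
    obtain ⟨p, b, hp7, hp, hb, h⟩ := exists_prime_mul_sub_eq (j := 28)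
      (by omega) two_pos rfl hc one_pos (by norm_num)
      (by rcases hb₀ with rfl | rfl <;> omega) (by omega)
    have hb8 : b % 8 = 1 := by omega
    have hp4 : p % 4 = 1 := by
      have hbn : (b * n) % 8 = 3 := by
        rw [Int.mul_emod, show (b : ℤ) % 8 = 1 by omega, show n % 8 = 3 by omega]; rfl
      omega
    obtain ⟨h2, h1⟩ := jacobiSym_values_of_mod_eight_eq_one hb8
    have hJ := jacobiSym_mul_of_mul_sub_eq h
    rw [h2, h1] at hJ
    refine represented_of_jacobiSym_eq_one (t := 2) hp7 hp (.inr rfl) (by linarith) ?_ (by omega)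
    rw [jacobiSym_neg_of_mod_four_eq_one (by omega) (hp.odd_of_ne_two (by omega)),
      ZMod.χ₄_nat_one_mod_four hp4]
    linarith
  · obtain ⟨c, hc⟩ : ∃ c, 17 * n - 2 * c = 7 := ⟨(17 * n - 7) / 2, by omega⟩
    obtain ⟨p, b, hp7, hp, hb, h⟩ := exists_prime_mul_sub_eq (j := 28)
      hn two_pos rfl hc (by norm_num) (by norm_num) (by omega) (by omega)
    have hb8 : b % 8 = 1 := by omega
    have hp4 : p % 4 = 3 := by
      have hbn : (b * n) % 8 = 5 := by
        rw [Int.mul_emod, show (b : ℤ) % 8 = 1 by omega, hn8]; rfl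
      omega
    obtain ⟨h2, _⟩ := jacobiSym_values_of_mod_eight_eq_one hb8
    have hJ := jacobiSym_mul_of_mul_sub_eq h
    rw [h2, jacobiSym_neg_seven (Nat.odd_iff.2 (by omega)),
      jacobiSym_seven_eq_neg_one (by omega)] at hJ
    refine represented_of_jacobiSym_eq_one (t := 2) hp7 hp (.inl rfl) (by linarith) ?_ (by omega)
    rw [jacobiSym_neg_of_mod_four_eq_one (by omega) (hp.odd_of_ne_two (by omega)),
      ZMod.χ₄_nat_three_mod_four hp4]
    linarith

theorem form_mod_sixteen_ne_two (x y z : ZMod 16) :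
    x ^ 2 + 3 * y ^ 2 + 2 * y * z + 5 * z ^ 2 ≠ 2 := by
  revert x y z
  decide +kernel

theorem two_mul_eq_zero_of_two_mul_form_eq_zero (x y z : ZMod 16)
    (h : 2 * (x ^ 2 + 3 * y ^ 2 + 2 * y * z + 5 * z ^ 2) = 0) :
    8 * x = 0 ∧ 8 * y = 0 ∧ 8 * z = 0 := by
  revert x y z
  decide +kernel

theorem form_ne_four_pow_mul (k l : ℕ) (x y z : ℤ) :
    x ^ 2 + 3 * y ^ 2 + 2 * y * z + 5 * z ^ 2 ≠ 4 ^ k * (16 * l + 2) := by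
  induction k generalizing x y z with
  | zero =>
    intro h
    have := congrArg (Int.cast : ℤ → ZMod 16) h
    push_cast at this
    rw [show (16 : ZMod 16) = 0 from rfl] at this
    exact form_mod_sixteen_ne_two x y z (by simpa using this)
  | succ k ih =>
    intro h
    have := congrArg (Int.cast : ℤ → ZMod 16) (congrArg (2 * ·) h)
    have h0 : (2 * (4 ^ (k + 1) * (16 * l + 2)) : ZMod 16) = 0 := by
      rw [show (2 * (4 ^ (k + 1) * (16 * l + 2)) : ZMod 16) = 16 * (4 ^ k * (8 * l + 1)) by ring,
        show (16 : ZMod 16) = 0 from rfl, zero_mul]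
    push_cast at this
    obtain ⟨hx, hy, hz⟩ := two_mul_eq_zero_of_two_mul_form_eq_zero x y z (by rw [this, h0])
    have half (w : ℤ) (hw : (8 * w : ZMod 16) = 0) : ∃ v, w = 2 * v := by
      have : ((16 : ℕ) : ℤ) ∣ 8 * w :=
        (ZMod.intCast_zmod_eq_zero_iff_dvd _ 16).1 (by push_cast; exact hw)
      exact ⟨w / 2, by omega⟩
    obtain ⟨x, rfl⟩ := half x hx
    obtain ⟨y, rfl⟩ := half y hy
    obtain ⟨z, rfl⟩ := half z hz
    exact ih x y z (by rw [pow_succ (4 : ℤ)] at h; linarith)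

theorem represented_of_ne_four_pow_mul (m : ℕ) (hm : 0 < m)
    (h : ∀ k l : ℕ, m ≠ 4 ^ k * (16 * l + 2)) :
    ∃ x y z : ℤ, x ^ 2 + 3 * y ^ 2 + 2 * y * z + 5 * z ^ 2 = m := by
  induction m using Nat.strong_induction_on with
  | _ m ih =>
    by_cases h4 : 4 ∣ m
    · obtain ⟨n, rfl⟩ := h4
      obtain ⟨x, y, z, hn⟩ := ih n (by omega) (by omega) fun k l hkl ↦
        h (k + 1) l (by rw [hkl]; ring)
      exact ⟨2 * x, 2 * y, 2 * z, by push_cast; linarith⟩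
    · rcases Nat.even_or_odd' m with ⟨n, rfl | hn⟩
      · have hn8 : n % 8 ≠ 1 := fun hn ↦ h 0 (n / 8) (by omega)
        push_cast
        by_cases hn4 : n % 4 = 3
        · exact represented_two_mul_of_mod_four_eq_three (by omega) (by omega)
        · exact represented_two_mul_of_mod_eight_eq_five (by omega) (by omega)
      · exact represented_of_odd (by omega) (by omega)

theorem stmt_2 (m : ℕ) (hm : 0 < m) :
    (∃ x y z : ℤ, x^2 + 3*y^2 + 2*y*z + 5*z^2 = (m : ℤ)) ↔ ¬ ∃ k l : ℕ, m = 4 ^ k * (16 * l + 2) := by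
  refine ⟨?_, fun h ↦ represented_of_ne_four_pow_mul m hm fun k l hkl ↦ h ⟨k, l, hkl⟩⟩
  rintro ⟨x, y, z, h⟩ ⟨k, l, rfl⟩
  exact form_ne_four_pow_mul k l x y z (by rw [h]; push_cast; ring)
end

section
/- A positive integer m is represented by the ternary quadratic form 2x^2 + 2xy + 3y^2 + 2yz + 5z^2 (i.e., there exist integers x, y, z with 2x^2 + 2xy + 3y^2 + 2yz + 5z^2 = m) if and only if m is not of the form 4^k(8ℓ + 1) for any nonnegative integers k and ℓ. -/
/-- The ternary form `a x² + b y² + c z² + 2 f y z + 2 g x z + 2 h x y`. -/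
def ternaryForm (a b c f g h x y z : ℤ) : ℤ :=
  a * x ^ 2 + b * y ^ 2 + c * z ^ 2 + 2 * f * y * z + 2 * g * x * z + 2 * h * x * y

/-- Coefficients of a positive definite ternary form of determinant `23` which is primitively
anisotropic modulo `4` and represents `m`. -/
structure IsAdmissible_s3 (m a b c f g h : ℤ) : Prop where
  pos : 0 < a
  minor_pos : 0 < a * b - h ^ 2
  det_eq : a * b * c + 2 * f * g * h - a * f ^ 2 - b * g ^ 2 - c * h ^ 2 = 23
  even_of_four_dvd : ∀ x y z, 4 ∣ ternaryForm a b c f g h x y z → 2 ∣ x ∧ 2 ∣ y ∧ 2 ∣ z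
  represents : ∃ x y z, ternaryForm a b c f g h x y z = m

namespace IsAdmissible_s3

variable {m a b c f g h : ℤ}

theorem minor_mul_minor (H : IsAdmissible_s3 m a b c f g h) :
    (a * b - h ^ 2) * (a * c - g ^ 2) = 23 * a + (a * f - g * h) ^ 2 := by
  linear_combination a * H.det_eq

theorem minor_pos' (H : IsAdmissible_s3 m a b c f g h) : 0 < a * c - g ^ 2 := by
  have h1 := H.minor_mul_minor
  have h2 := H.pos
  have h3 := H.minor_pos
  by_contra! h4
  nlinarith [sq_nonneg (a * f - g * h)]

theorem swap_fst_snd_s3 (H : IsAdmissible_s3 m a b c f g h) : IsAdmissible_s3 m b a c g f h where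
  pos := by
    have h1 := H.pos
    have h2 := H.minor_pos
    by_contra! h3
    nlinarith [sq_nonneg h]
  minor_pos := by linarith [H.minor_pos]
  det_eq := by linear_combination H.det_eq
  even_of_four_dvd x y z hd := by
    have := H.even_of_four_dvd y x z (by unfold ternaryForm at *; convert hd using 1; ring)
    tauto
  represents := by
    obtain ⟨x, y, z, e⟩ := H.represents
    exact ⟨y, x, z, by rw [← e]; unfold ternaryForm; ring⟩

theorem swap_snd_trd_s3 (H : IsAdmissible_s3 m a b c f g h) : IsAdmissible_s3 m a c b f h g where
  pos := H.pos
  minor_pos := H.minor_pos'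
  det_eq := by linear_combination H.det_eq
  even_of_four_dvd x y z hd := by
    have := H.even_of_four_dvd x z y (by unfold ternaryForm at *; convert hd using 1; ring)
    tauto
  represents := by
    obtain ⟨x, y, z, e⟩ := H.represents
    exact ⟨x, z, y, by rw [← e]; unfold ternaryForm; ring⟩

theorem shear_fst_snd (H : IsAdmissible_s3 m a b c f g h) (t : ℤ) :
    IsAdmissible_s3 m a (b + 2 * t * h + t ^ 2 * a) c (f + t * g) g (h + t * a) where
  pos := H.pos
  minor_pos := by linarith [H.minor_pos]
  det_eq := by linear_combination H.det_eq
  even_of_four_dvd x y z hd := by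
    have := H.even_of_four_dvd (x + t * y) y z
      (by unfold ternaryForm at *; convert hd using 1; ring)
    exact ⟨(Int.dvd_add_left (this.2.1.mul_left t)).1 this.1, this.2⟩
  represents := by
    obtain ⟨x, y, z, e⟩ := H.represents
    exact ⟨x - t * y, y, z, by rw [← e]; unfold ternaryForm; ring⟩

theorem shear_fst_trd (H : IsAdmissible_s3 m a b c f g h) (t : ℤ) :
    IsAdmissible_s3 m a b (c + 2 * t * g + t ^ 2 * a) (f + t * h) (g + t * a) h :=
  (H.swap_snd_trd_s3.shear_fst_snd t).swap_snd_trd_s3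

theorem shear_snd_trd (H : IsAdmissible_s3 m a b c f g h) (t : ℤ) :
    IsAdmissible_s3 m a b (c + 2 * t * f + t ^ 2 * b) (f + t * b) (g + t * h) h :=
  (H.swap_fst_snd_s3.shear_fst_trd t).swap_fst_snd_s3

end IsAdmissible_s3

theorem exists_two_mul_add_mul_mem_Icc {a : ℤ} (ha : 0 < a) (h : ℤ) :
    ∃ t, -a ≤ 2 * (h + t * a) ∧ 2 * (h + t * a) ≤ a := by
  refine ⟨-((2 * h + a) / (2 * a)), ?_⟩
  have h1 := Int.emod_add_mul_ediv (2 * h + a) (2 * a)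
  have h2 := Int.emod_nonneg (2 * h + a) (show 2 * a ≠ 0 by positivity)
  have h3 := Int.emod_lt_of_pos (2 * h + a) (show 0 < 2 * a by positivity)
  constructor <;> linarith

/-- Every admissible form is equivalent to one satisfying the inequalities of Gauss reduction. -/
theorem IsAdmissible_s3.exists_reduced {m a₀ b₀ c₀ f₀ g₀ h₀ : ℤ}
    (H₀ : IsAdmissible_s3 m a₀ b₀ c₀ f₀ g₀ h₀) :
    ∃ a b c f g h, IsAdmissible_s3 m a b c f g h ∧ a ≤ b ∧
      a * b - h ^ 2 ≤ a * c - g ^ 2 ∧ (-a ≤ 2 * h ∧ 2 * h ≤ a) ∧ (-a ≤ 2 * g ∧ 2 * g ≤ a) ∧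
      (-(a * b - h ^ 2) ≤ 2 * (a * f - g * h) ∧ 2 * (a * f - g * h) ≤ a * b - h ^ 2) := by
  classical
  have ex : ∃ n : ℕ, ∃ b c f g h, IsAdmissible_s3 m n b c f g h :=
    ⟨a₀.toNat, b₀, c₀, f₀, g₀, h₀, by rwa [Int.toNat_of_nonneg H₀.pos.le]⟩
  obtain ⟨b₁, c₁, f₁, g₁, h₁, H₁⟩ := Nat.find_spec ex
  have a_min : ∀ a b c f g h, IsAdmissible_s3 m a b c f g h → (Nat.find ex : ℤ) ≤ a := by
    intro a b c f g h H
    have := Nat.find_min' ex ⟨b, c, f, g, h,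
      (show IsAdmissible_s3 m (a.toNat : ℤ) b c f g h by rwa [Int.toNat_of_nonneg H.pos.le])⟩
    have := H.pos
    omega
  generalize (Nat.find ex : ℤ) = a at *
  have ex' : ∃ n : ℕ, ∃ b c f g h, IsAdmissible_s3 m a b c f g h ∧ a * b - h ^ 2 = n :=
    ⟨_, b₁, c₁, f₁, g₁, h₁, H₁, (Int.toNat_of_nonneg H₁.minor_pos.le).symm⟩
  obtain ⟨b₂, c₂, f₂, g₂, h₂, H₂, e₂⟩ := Nat.find_spec ex'
  have A_min : ∀ b c f g h, IsAdmissible_s3 m a b c f g h →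
      (Nat.find ex' : ℤ) ≤ a * b - h ^ 2 := by
    intro b c f g h H
    have := Nat.find_min' ex' ⟨b, c, f, g, h, H, (Int.toNat_of_nonneg H.minor_pos.le).symm⟩
    have := H.minor_pos
    omega
  generalize (Nat.find ex' : ℤ) = A at *
  obtain ⟨t, ht⟩ := exists_two_mul_add_mul_mem_Icc H₂.minor_pos (a * f₂ - g₂ * h₂)
  obtain ⟨u, hu⟩ := exists_two_mul_add_mul_mem_Icc H₂.pos h₂
  obtain ⟨v, hv⟩ := exists_two_mul_add_mul_mem_Icc H₂.pos (g₂ + t * h₂)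
  have H := ((H₂.shear_snd_trd t).shear_fst_snd u).shear_fst_trd v
  refine ⟨_, _, _, _, _, _, H, a_min _ _ _ _ _ _ H.swap_fst_snd_s3, ?_, hu, hv, ?_⟩
  · refine le_trans (le_of_eq ?_) (A_min _ _ _ _ _ H.swap_snd_trd_s3)
    rw [← e₂]; ring
  · constructor
    · linarith [ht.1]
    · linarith [ht.2]

/-- The Gauss reduced positive definite ternary forms of determinant `23`. -/
theorem eq_of_reduced {a b c f g h : ℤ} (ha : 0 < a) (hA : 0 < a * b - h ^ 2)
    (hdet : a * b * c + 2 * f * g * h - a * f ^ 2 - b * g ^ 2 - c * h ^ 2 = 23)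
    (hab : a ≤ b) (hAC : a * b - h ^ 2 ≤ a * c - g ^ 2) (hh : -a ≤ 2 * h ∧ 2 * h ≤ a)
    (hg : -a ≤ 2 * g ∧ 2 * g ≤ a)
    (hB : -(a * b - h ^ 2) ≤ 2 * (a * f - g * h) ∧ 2 * (a * f - g * h) ≤ a * b - h ^ 2) :
    (a = 1 ∧ h = 0 ∧ g = 0 ∧ (b = 1 ∧ c = 23 ∧ f = 0 ∨ b = 2 ∧ c = 12 ∧ (f = 1 ∨ f = -1) ∨
      b = 3 ∧ c = 8 ∧ (f = 1 ∨ f = -1) ∨ b = 4 ∧ c = 6 ∧ (f = 1 ∨ f = -1))) ∨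
    (a = 2 ∧ b = 3 ∧ c = 5 ∧ g = 0 ∧ (f = 1 ∨ f = -1) ∧ (h = 1 ∨ h = -1)) := by
  have hmul : (a * b - h ^ 2) * (a * c - g ^ 2) = 23 * a + (a * f - g * h) ^ 2 := by
    linear_combination a * hdet
  have hA_le : 3 * (a * b - h ^ 2) ^ 2 ≤ 92 * a := by
    have : 4 * (a * f - g * h) ^ 2 ≤ (a * b - h ^ 2) ^ 2 := by nlinarith
    nlinarith
  have hA_ge : 3 * a ^ 2 ≤ 4 * (a * b - h ^ 2) := by
    have : 4 * h ^ 2 ≤ a ^ 2 := by nlinarith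
    nlinarith
  have ha3 : a ≤ 3 := by
    by_contra! h4
    have h1 : (3 * a ^ 2) ^ 2 ≤ (4 * (a * b - h ^ 2)) ^ 2 := by gcongr
    have h2 : 4 ^ 3 ≤ a ^ 3 := by gcongr; omega
    nlinarith
  have hA_le' : a * b - h ^ 2 ≤ 2 * a + 3 := by
    by_contra! h4
    have h1 : (2 * a + 4) ^ 2 ≤ (a * b - h ^ 2) ^ 2 := by gcongr; omega
    nlinarith [sq_nonneg (6 * a - 11)]
  have hh₁ : -1 ≤ h := by omega
  have hh₂ : h ≤ 1 := by omega
  have hg₁ : -1 ≤ g := by omega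
  have hg₂ : g ≤ 1 := by omega
  clear hA_le hmul
  have hb : b ≤ 5 := by interval_cases a <;> interval_cases h <;> omega
  have hf : -2 ≤ f ∧ f ≤ 2 := by
    interval_cases a <;> interval_cases h <;> interval_cases g <;> omega
  obtain ⟨hf₁, hf₂⟩ := hf
  interval_cases a <;> interval_cases h <;> try omega
  all_goals interval_cases g <;> try omega
  all_goals interval_cases b <;> try omega
  all_goals interval_cases f <;> omega

theorem IsAdmissible_s3.exists_eq {m a₀ b₀ c₀ f₀ g₀ h₀ : ℤ}
    (H₀ : IsAdmissible_s3 m a₀ b₀ c₀ f₀ g₀ h₀) :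
    ∃ x y z : ℤ, 2 * x ^ 2 + 2 * x * y + 3 * y ^ 2 + 2 * y * z + 5 * z ^ 2 = m := by
  obtain ⟨a, b, c, f, g, h, H, hab, hAC, hh, hg, hB⟩ := H₀.exists_reduced
  rcases eq_of_reduced H.pos H.minor_pos H.det_eq hab hAC hh hg hB with
    ⟨rfl, rfl, rfl, hbcf⟩ | ⟨rfl, rfl, rfl, rfl, hf, hh⟩
  · have anis₁ := H.even_of_four_dvd 0 1 0
    have anis₂ := H.even_of_four_dvd 0 0 1
    have anis₃ := H.even_of_four_dvd 0 1 1
    have anis₄ := H.even_of_four_dvd 1 1 0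
    have anis₅ := H.even_of_four_dvd 1 0 1
    have anis₆ := H.even_of_four_dvd 1 1 1
    simp only [ternaryForm] at anis₁ anis₂ anis₃ anis₄ anis₅ anis₆
    rcases hbcf with ⟨rfl, rfl, rfl⟩ | ⟨rfl, rfl, rfl | rfl⟩ | ⟨rfl, rfl, rfl | rfl⟩ |
      ⟨rfl, rfl, rfl | rfl⟩ <;> norm_num at *
  · obtain ⟨x, y, z, e⟩ := H.represents
    unfold ternaryForm at e
    refine ⟨h * x, y, f * z, ?_⟩
    rcases hf with rfl | rfl <;> rcases hh with rfl | rfl <;> linear_combination e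

/-- A criterion producing an admissible form that represents `m`. -/
theorem isAdmissible_of_mul_eq {m n a b h : ℤ} (hn : 0 < n) (hb : 0 < b)
    (hab : a * b = h ^ 2 + n) (hbn : b = 23 * m * n - 1)
    (anis : ∀ x y z : ℤ, 4 ∣ ternaryForm (23 * a) (23 * b) m 0 1 (23 * h) x y z →
      2 ∣ x ∧ 2 ∣ y ∧ 2 ∣ z) :
    IsAdmissible_s3 m (23 * a) (23 * b) m 0 1 (23 * h) where
  pos := by
    have : 0 < a * b := by rw [hab]; positivity
    have := pos_of_mul_pos_left this hb.le
    positivity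
  minor_pos := by nlinarith
  det_eq := by linear_combination 529 * m * hab - 23 * hbn
  even_of_four_dvd := anis
  represents := ⟨0, 0, 1, by simp [ternaryForm]⟩

theorem exists_prime_of_odd {u c M : ℕ} (hM : u * c + 1 = M) (hc : Odd c) :
    ∃ p k : ℕ, p.Prime ∧ p = c + 4 * (M * k) ∧ u * p + 1 = M * (1 + 4 * u * k) := by
  have hcM : c.Coprime M := by
    rw [← hM, Nat.coprime_mul_right_add_right]
    exact Nat.coprime_one_right c
  have hcop : c.Coprime (4 * M) :=
    Nat.Coprime.mul_right ((Nat.coprime_two_right.2 hc).pow_right 2) hcM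
  obtain ⟨p, hp, hprime, hmod⟩ := Nat.forall_exists_prime_gt_and_modEq c (by omega) hcop
  obtain ⟨k, hk⟩ := (Nat.modEq_iff_dvd' hp.le).1 hmod.symm
  have hpc : p = c + 4 * (M * k) := by
    rw [← mul_assoc, ← hk, Nat.add_sub_cancel' hp.le]
  exact ⟨p, k, hprime, hpc, by rw [hpc]; linear_combination hM⟩

theorem exists_dvd_sq_add_of_jacobiSym_eq_one {p n : ℕ} (hp : p.Prime)
    (h : jacobiSym (-n) p = 1) : ∃ s : ℤ, (p : ℤ) ∣ s ^ 2 + n := by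
  have := Fact.mk hp
  obtain ⟨s, hs⟩ := ZMod.isSquare_of_jacobiSym_eq_one h
  obtain ⟨s, rfl⟩ := ZMod.intCast_surjective s
  refine ⟨s, (ZMod.intCast_zmod_eq_zero_iff_dvd _ p).1 ?_⟩
  push_cast at hs ⊢
  linear_combination -hs

theorem even_of_four_dvd_ternaryForm {a b c f g h : ℤ}
    (H : ∀ x y z : ZMod 4, a * x ^ 2 + b * y ^ 2 + c * z ^ 2 + 2 * f * y * z + 2 * g * x * z +
      2 * h * x * y = 0 → 2 * x = 0 ∧ 2 * y = 0 ∧ 2 * z = 0) (x y z : ℤ)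
    (hd : 4 ∣ ternaryForm a b c f g h x y z) : 2 ∣ x ∧ 2 ∣ y ∧ 2 ∣ z := by
  have two_dvd (t : ℤ) (ht : 2 * (t : ZMod 4) = 0) : 2 ∣ t := by
    have := (ZMod.intCast_zmod_eq_zero_iff_dvd (2 * t) 4).1 (by exact_mod_cast ht)
    omega
  have h0 := (ZMod.intCast_zmod_eq_zero_iff_dvd _ 4).2 hd
  unfold ternaryForm at h0
  push_cast at h0
  exact (H x y z h0).imp (two_dvd x) (.imp (two_dvd y) (two_dvd z))

theorem jacobiSym_neg_eq_one_of_dvd_add_one {n p : ℕ} (hn : n % 4 = 1) (hp : p % 4 = 1)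
    (h : n ∣ p + 1) : jacobiSym (-n) p = 1 := by
  have hp2 : Odd p := by rw [Nat.odd_iff]; omega
  have hn2 : Odd n := by rw [Nat.odd_iff]; omega
  rw [jacobiSym.neg _ hp2, ZMod.χ₄_nat_one_mod_four hp, one_mul,
    jacobiSym.quadratic_reciprocity_one_mod_four hn hp2]
  have : (p : ℤ) % n = (-1 : ℤ) % n := by
    refine Int.emod_eq_emod_iff_emod_sub_eq_zero.2 (Int.emod_eq_zero_of_dvd ?_)
    simpa using Int.natCast_dvd_natCast.2 h
  rw [jacobiSym.mod_left' this, jacobiSym.at_neg_one hn2, ZMod.χ₄_nat_one_mod_four hn]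

theorem jacobiSym_neg_two_mul_eq_one_of_dvd_add_one {n p : ℕ} (hn : n % 4 = 1) (hp : p % 8 = 1)
    (h : n ∣ p + 1) : jacobiSym (-(2 * n : ℕ)) p = 1 := by
  have hp2 : Odd p := by rw [Nat.odd_iff]; omega
  have h2 : jacobiSym 2 p = 1 := by
    rw [jacobiSym.at_two hp2, ZMod.χ₈_nat_eq_if_mod_eight]
    simp [hp, Nat.odd_iff.1 hp2]
  rw [Nat.cast_mul, ← mul_neg, jacobiSym.mul_left, Nat.cast_two, h2, one_mul,
    jacobiSym_neg_eq_one_of_dvd_add_one hn (by omega) h]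

theorem jacobiSym_neg_eq_one_of_dvd_two_mul_add_one {n p : ℕ} (hn : n % 8 = 1) (hp : p % 4 = 1)
    (h : n ∣ 2 * p + 1) : jacobiSym (-n) p = 1 := by
  have hp2 : Odd p := by rw [Nat.odd_iff]; omega
  have hn2 : Odd n := by rw [Nat.odd_iff]; omega
  have h2 : jacobiSym 2 n = 1 := by
    rw [jacobiSym.at_two hn2, ZMod.χ₈_nat_eq_if_mod_eight]
    simp [hn, Nat.odd_iff.1 hn2]
  have : ((2 * p : ℤ)) % n = (-1 : ℤ) % n := by
    refine Int.emod_eq_emod_iff_emod_sub_eq_zero.2 (Int.emod_eq_zero_of_dvd ?_)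
    simpa using Int.natCast_dvd_natCast.2 h
  have hpn : jacobiSym p n = 1 := by
    rw [← one_mul (jacobiSym p n)]
    nth_rw 1 [← h2]
    rw [← jacobiSym.mul_left, jacobiSym.mod_left' this, jacobiSym.at_neg_one hn2,
      ZMod.χ₄_nat_one_mod_four (by omega)]
  rw [jacobiSym.neg _ hp2, ZMod.χ₄_nat_one_mod_four hp, one_mul,
    jacobiSym.quadratic_reciprocity_one_mod_four (by omega) hp2, hpn]

theorem exists_isAdmissible_of_mod_four_eq_two {m : ℕ} (hm : m % 4 = 2) :
    ∃ a b c f g h, IsAdmissible_s3 m a b c f g h := by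
  obtain ⟨p, k, hp, hpc, hpk⟩ := exists_prime_of_odd (u := 1) (c := 23 * m - 1) (M := 23 * m)
    (by omega) (by rw [Nat.odd_iff]; omega)
  have hp4 : p % 4 = 1 := by omega
  rw [mul_one, one_mul] at hpk
  obtain ⟨s, a, hs⟩ := exists_dvd_sq_add_of_jacobiSym_eq_one hp
    (jacobiSym_neg_eq_one_of_dvd_add_one (n := 1 + 4 * k) (by omega) hp4
      ⟨_, hpk.trans (mul_comm _ _)⟩)
  refine ⟨_, _, _, _, _, _, isAdmissible_of_mul_eq (n := (1 + 4 * k : ℕ)) (a := a) (b := p) (h := s)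
    (by positivity) (mod_cast hp.pos) (by linear_combination -hs)
    (by rw [eq_sub_iff_add_eq]; exact_mod_cast hpk) (even_of_four_dvd_ternaryForm ?_)⟩
  have hpz : (p : ZMod 4) = 1 := mod_cast (ZMod.natCast_eq_natCast_iff' p 1 4).2 hp4
  have hmz : (m : ZMod 4) = 2 := mod_cast (ZMod.natCast_eq_natCast_iff' m 2 4).2 hm
  have haz : (a : ZMod 4) = s ^ 2 + 1 := by
    have h := congrArg (Int.cast : ℤ → ZMod 4) hs
    have h4 : (4 : ZMod 4) = 0 := by decide
    push_cast [hpz] at h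
    linear_combination -h + k * h4
  push_cast [hpz, hmz, haz]
  generalize (s : ZMod 4) = s
  revert s
  decide

theorem exists_isAdmissible_of_mod_four_eq_three {m : ℕ} (hm : m % 4 = 3) :
    ∃ a b c f g h, IsAdmissible_s3 m a b c f g h := by
  obtain ⟨p, k, hp, hpc, hpk⟩ := exists_prime_of_odd (u := 1) (c := 46 * m - 1) (M := 46 * m)
    (by omega) (by rw [Nat.odd_iff]; omega)
  have hp8 : p % 8 = 1 := by
    rw [mul_assoc 46] at hpc
    omega
  rw [mul_one, one_mul] at hpk
  obtain ⟨s, a, hs⟩ := exists_dvd_sq_add_of_jacobiSym_eq_one hp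
    (jacobiSym_neg_two_mul_eq_one_of_dvd_add_one (n := 1 + 4 * k) (by omega) hp8
      ⟨_, hpk.trans (mul_comm _ _)⟩)
  refine ⟨_, _, _, _, _, _, isAdmissible_of_mul_eq (n := (2 * (1 + 4 * k) : ℕ)) (a := a) (b := p)
    (h := s) (by positivity) (mod_cast hp.pos) (by linear_combination -hs)
    (by rw [eq_sub_iff_add_eq]; exact_mod_cast hpk.trans (by ring))
    (even_of_four_dvd_ternaryForm ?_)⟩
  have hpz : (p : ZMod 4) = 1 := mod_cast (ZMod.natCast_eq_natCast_iff' p 1 4).2 (by omega)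
  have hmz : (m : ZMod 4) = 3 := mod_cast (ZMod.natCast_eq_natCast_iff' m 3 4).2 hm
  have haz : (a : ZMod 4) = s ^ 2 + 2 := by
    have h := congrArg (Int.cast : ℤ → ZMod 4) hs
    have h4 : (4 : ZMod 4) = 0 := by decide
    push_cast [hpz] at h
    linear_combination -h + 2 * k * h4
  push_cast [hpz, hmz, haz]
  generalize (s : ZMod 4) = s
  revert s
  decide

theorem exists_isAdmissible_of_mod_eight_eq_five {m : ℕ} (hm : m % 8 = 5) :
    ∃ a b c f g h, IsAdmissible_s3 m a b c f g h := by
  obtain ⟨p, k, hp, hpc, hpk⟩ := exists_prime_of_odd (u := 2) (c := (23 * m - 1) / 2)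
    (M := 23 * m) (by omega) (by rw [Nat.odd_iff]; omega)
  have hp4 : p % 4 = 1 := by omega
  obtain ⟨s₀, hs₀⟩ := exists_dvd_sq_add_of_jacobiSym_eq_one hp
    (jacobiSym_neg_eq_one_of_dvd_two_mul_add_one (n := 1 + 4 * 2 * k) (by omega) hp4
      ⟨_, hpk.trans (mul_comm _ _)⟩)
  obtain ⟨r, a₀, hs⟩ : ∃ r : ℤ, (p : ℤ) ∣ (2 * r + 1) ^ 2 + (1 + 4 * 2 * k : ℕ) := by
    rcases Int.even_or_odd' s₀ with ⟨r, rfl | rfl⟩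
    · refine ⟨r + p / 2, ?_⟩
      obtain ⟨d, hd⟩ := hs₀
      have hrp : 2 * (r + p / 2) + 1 = 2 * r + (p : ℤ) := by omega
      exact ⟨d + 4 * r + p, by rw [hrp]; linear_combination hd⟩
    · exact ⟨r, hs₀⟩
  obtain ⟨j, hj⟩ : ∃ j : ℤ, (p : ℤ) = 4 * j + 1 := ⟨p / 4, by omega⟩
  obtain ⟨i, hi⟩ := Int.even_mul_succ_self r
  obtain ⟨a, rfl⟩ : 2 ∣ a₀ := by
    refine ⟨2 * r * (r + 1) + 1 + 4 * k - 2 * j * a₀, ?_⟩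
    push_cast at hs
    linear_combination -hs - a₀ * hj
  refine ⟨_, _, _, _, _, _, isAdmissible_of_mul_eq (n := (1 + 4 * 2 * k : ℕ)) (a := a)
    (b := 2 * p) (h := 2 * r + 1) (by positivity) (by have := hp.pos; positivity)
    (by linear_combination -hs) (by rw [eq_sub_iff_add_eq]; exact_mod_cast hpk)
    (even_of_four_dvd_ternaryForm ?_)⟩
  have h4 : (4 : ZMod 4) = 0 := by decide
  have hpz : (p : ZMod 4) = 1 := mod_cast (ZMod.natCast_eq_natCast_iff' p 1 4).2 hp4
  have hmz : (m : ZMod 4) = 1 := mod_cast (ZMod.natCast_eq_natCast_iff' m 1 4).2 (by omega)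
  have haz : (a : ZMod 4) = 1 := by
    have : a = 1 + 4 * (i + k - j * a) := by
      push_cast at hs
      refine mul_left_cancel₀ two_ne_zero ?_
      linear_combination -hs - 2 * a * hj + 4 * hi
    rw [this]
    push_cast
    linear_combination (i + k - j * a) * h4
  push_cast [hpz, hmz, haz]
  generalize (r : ZMod 4) = r
  revert r
  decide

theorem stmt_3 (m : ℕ) (hm : 0 < m) :
    (∃ x y z : ℤ, 2*x^2 + 2*x*y + 3*y^2 + 2*y*z + 5*z^2 = (m : ℤ)) ↔ ¬ ∃ k l : ℕ, m = 4 ^ k * (8 * l + 1) := by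
  constructor
  · rintro ⟨x, y, z, e⟩ ⟨k, l, rfl⟩
    clear hm
    induction k generalizing x y z with
    | zero =>
      have h := congrArg (Int.cast : ℤ → ZMod 8) e
      have h8 : (8 : ZMod 8) = 0 := by decide
      push_cast [h8] at h
      generalize (x : ZMod 8) = x, (y : ZMod 8) = y, (z : ZMod 8) = z at h
      simp only [zero_mul, zero_add, mul_one] at h
      revert x y z
      decide
    | succ k ih =>
      have anis := even_of_four_dvd_ternaryForm (a := 2) (b := 3) (c := 5) (f := 1) (g := 0)
        (h := 1) (by push_cast; decide) x y z
        ⟨4 ^ k * (8 * l + 1), by unfold ternaryForm; push_cast at e; linear_combination e⟩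
      obtain ⟨⟨x, rfl⟩, ⟨y, rfl⟩, ⟨z, rfl⟩⟩ := anis
      refine ih x y z ?_
      push_cast at e ⊢
      rw [pow_succ 4 k] at e
      linarith
  · intro hml
    induction m using Nat.strong_induction_on with
    | _ m ih =>
      by_cases h4 : 4 ∣ m
      · obtain ⟨m, rfl⟩ := h4
        obtain ⟨x, y, z, e⟩ := ih m (by omega) (by omega) (by
          rintro ⟨k, l, rfl⟩
          exact hml ⟨k + 1, l, by ring⟩)
        refine ⟨2 * x, 2 * y, 2 * z, ?_⟩
        push_cast
        linear_combination 4 * e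
      · have h1 : m % 8 ≠ 1 := fun h1 ↦ hml ⟨0, m / 8, by omega⟩
        have : m % 4 = 2 ∨ m % 4 = 3 ∨ m % 8 = 5 := by omega
        obtain ⟨a, b, c, f, g, h, H⟩ : ∃ a b c f g h, IsAdmissible_s3 m a b c f g h := by
          rcases this with h | h | h
          · exact exists_isAdmissible_of_mod_four_eq_two h
          · exact exists_isAdmissible_of_mod_four_eq_three h
          · exact exists_isAdmissible_of_mod_eight_eq_five h
        exact H.exists_eq
end

section
/- Let m be an odd positive integer. Then m is represented by the ternary quadratic form 2x^2 + 2xy + 3y^2 + 2yz + 5z^2 if and only if 4m is represented by the same form. -/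
/-- The form `2x² + 2xy + 3y² + 2yz + 5z²` is anisotropic modulo `4`, up to even vectors. -/
theorem even_of_four_dvd_form {x y z : ℤ}
    (h : 4 ∣ 2*x^2 + 2*x*y + 3*y^2 + 2*y*z + 5*z^2) : 2 ∣ x ∧ 2 ∣ y ∧ 2 ∣ z := by
  have key : ∀ a b c : ZMod 4, 2*a^2 + 2*a*b + 3*b^2 + 2*b*c + 5*c^2 = 0 →
      2*a = 0 ∧ 2*b = 0 ∧ 2*c = 0 := by decide
  have cast_two_mul (a : ℤ) (ha : (2 * a : ZMod 4) = 0) : 2 ∣ a := by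
    have : ((2 * a : ℤ) : ZMod 4) = 0 := by exact_mod_cast ha
    have := (ZMod.intCast_zmod_eq_zero_iff_dvd (2 * a) 4).1 this
    omega
  obtain ⟨hx, hy, hz⟩ := key x y z
    (by exact_mod_cast (ZMod.intCast_zmod_eq_zero_iff_dvd _ 4).2 h)
  exact ⟨cast_two_mul x hx, cast_two_mul y hy, cast_two_mul z hz⟩

theorem stmt_15 (m : ℕ) (hm : 0 < m) (hodd : Odd m) :
    (∃ x y z : ℤ, 2*x^2 + 2*x*y + 3*y^2 + 2*y*z + 5*z^2 = (m : ℤ)) ↔ (∃ x y z : ℤ, 2*x^2 + 2*x*y + 3*y^2 + 2*y*z + 5*z^2 = (4 * m : ℤ)) := by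
  constructor
  · rintro ⟨x, y, z, h⟩
    exact ⟨2*x, 2*y, 2*z, by linear_combination 4 * h⟩
  · rintro ⟨x, y, z, h⟩
    obtain ⟨⟨a, rfl⟩, ⟨b, rfl⟩, ⟨c, rfl⟩⟩ := even_of_four_dvd_form ⟨_, h⟩
    exact ⟨a, b, c, by linarith⟩
end
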